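/- There exists ε_0 > 0 such that for all 0 < ε < ε_0 all of the following pairs of points in ℝ⁵ have Euclidean distance at least 1 + ε, for all a_1 ∈ A_1, a_2 ∈ A_2 and i, j ∈ {1,…,M}: (q, s_2*) for every q ∈ Q_1 that is not of the form s_1(a_1); (q, t_2*) for every q ∈ Q_1 that is not of the form t_1(a_1); (r_1(a_1), CG(a_2,i)); (CG(a_1,i), r_2(a_2)); (CG(a_1,i), CG(a_2,j)) whenever i ≢ j (mod 2); and (CG(a_1,i), CG(a_2,i)) whenever sat_1(a_1,i) = F and sat_2(a_2,i) = F. -/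

import Mathlib

noncomputable section
open Real

/-- A point of the Euclidean plane. -/
def pt (x y : ℝ) : EuclideanSpace ℝ (Fin 2) := (WithLp.equiv 2 (Fin 2 → ℝ)).symm ![x, y]
/-- A point of `ℝ⁵`. -/
def pt5 (a b c d e : ℝ) : EuclideanSpace ℝ (Fin 5) :=
  (WithLp.equiv 2 (Fin 5 → ℝ)).symm ![a, b, c, d, e]

/-- `ρ = 1/√2`. -/
def rho : ℝ := 1 / Real.sqrt 2

/-- The point `rot(a_1^h, i)`, placed on a quarter-circle in the `(1,2)`-plane;
`M` is the number of clauses and `K1 = |A_1|`. -/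
def rot1 (M K1 : ℕ) (h i : ℕ) : EuclideanSpace ℝ (Fin 5) :=
  pt5 (rho * Real.sin (π / 4 + (π / 2) * ((h * (M + 2) + i : ℕ) : ℝ) / ((K1 * (M + 2) : ℕ) : ℝ)))
      (rho * Real.cos (π / 4 + (π / 2) * ((h * (M + 2) + i : ℕ) : ℝ) / ((K1 * (M + 2) : ℕ) : ℝ)))
      0 0 0

/-- The point `rot(a_2^h, i)`, placed on a quarter-circle in the `(3,4)`-plane;
`M` is the number of clauses and `K2 = |A_2|`. -/
def rot2 (M K2 : ℕ) (h i : ℕ) : EuclideanSpace ℝ (Fin 5) :=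
  pt5 0 0
      (rho * Real.sin (π / 4 + (π / 2) * ((h * (M + 2) + i : ℕ) : ℝ) / ((K2 * (M + 2) : ℕ) : ℝ)))
      (rho * Real.cos (π / 4 + (π / 2) * ((h * (M + 2) + i : ℕ) : ℝ) / ((K2 * (M + 2) : ℕ) : ℝ)))
      0
/-- `e_5 = (0,0,0,0,ρ)`. -/
def e5 : EuclideanSpace ℝ (Fin 5) := pt5 0 0 0 0 rho

/-- The clause gadget `CG(a_1, i)` in `ℝ⁵` (as a function of `ε`). -/
def CG5_1 (M K1 : ℕ) (sat1 : ℕ → ℕ → Bool) (ε : ℝ) (h i : ℕ) : EuclideanSpace ℝ (Fin 5) :=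
  (if sat1 h i then 1 - 2 * ε else 1 + ε) • rot1 M K1 h i +
    ((i % 2 : ℕ) : ℝ) • (8 * Real.sqrt ε) • e5

/-- The clause gadget `CG(a_2, i)` in `ℝ⁵`. -/
def CG5_2 (M K2 : ℕ) (sat2 : ℕ → ℕ → Bool) (ε : ℝ) (h i : ℕ) : EuclideanSpace ℝ (Fin 5) :=
  (if sat2 h i then 1 - 2 * ε else 1 + ε) • rot2 M K2 h i +
    ((i % 2 : ℕ) : ℝ) • (8 * Real.sqrt ε) • e5

/-- `r_1(a_1) = rot(a_1, 0) − 8√ε·e_5`. -/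
def rp1 (M K1 : ℕ) (ε : ℝ) (h : ℕ) : EuclideanSpace ℝ (Fin 5) :=
  rot1 M K1 h 0 - (8 * Real.sqrt ε) • e5

/-- `r_2(a_2) = rot(a_2, 0) − 8√ε·e_5`. -/
def rp2 (M K2 : ℕ) (ε : ℝ) (h : ℕ) : EuclideanSpace ℝ (Fin 5) :=
  rot2 M K2 h 0 - (8 * Real.sqrt ε) • e5

/-- `s_1(a_1) = (1−400ε)·rot(a_1, 0) + 10√ε·e_5`. -/
def sp1 (M K1 : ℕ) (ε : ℝ) (h : ℕ) : EuclideanSpace ℝ (Fin 5) :=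
  (1 - 400 * ε) • rot1 M K1 h 0 + (10 * Real.sqrt ε) • e5

/-- `t_1(a_1) = (1−400ε)·rot(a_1, M+1) − 10√ε·e_5`. -/
def tp1 (M K1 : ℕ) (ε : ℝ) (h : ℕ) : EuclideanSpace ℝ (Fin 5) :=
  (1 - 400 * ε) • rot1 M K1 h (M + 1) - (10 * Real.sqrt ε) • e5

/-- `s_2 = (0,0,0,0,0)`. -/
def sp2 : EuclideanSpace ℝ (Fin 5) := 0

/-- `t_2 = (0,0,0,0,0)`. -/
def tp2 : EuclideanSpace ℝ (Fin 5) := 0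

/-- `s_2* = (1+9√ε)·e_5`. -/
def sp2star (ε : ℝ) : EuclideanSpace ℝ (Fin 5) := (1 + 9 * Real.sqrt ε) • e5

/-- `t_2* = −(1+9√ε)·e_5`. -/
def tp2star (ε : ℝ) : EuclideanSpace ℝ (Fin 5) := -((1 + 9 * Real.sqrt ε) • e5)

/-- The set `Q_1` of vertices that may appear on the first curve; elements of `A_1`
are encoded by their index `h ∈ {1,…,K1}` in the enumeration. -/
def Q1 (M K1 : ℕ) (sat1 : ℕ → ℕ → Bool) (ε : ℝ) : Set (EuclideanSpace ℝ (Fin 5)) :=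
  {q | ∃ h : ℕ, 1 ≤ h ∧ h ≤ K1 ∧
    (q = sp1 M K1 ε h ∨ q = tp1 M K1 ε h ∨ q = rp1 M K1 ε h ∨
      ∃ i : ℕ, 1 ≤ i ∧ i ≤ M ∧ q = CG5_1 M K1 sat1 ε h i)}

/-- The set `Q_2` of vertices that may appear on the second curve. -/
def Q2 (M K2 : ℕ) (sat2 : ℕ → ℕ → Bool) (ε : ℝ) : Set (EuclideanSpace ℝ (Fin 5)) :=
  {q | q = sp2 ∨ q = tp2 ∨ q = sp2star ε ∨ q = tp2star ε ∨
    ∃ h : ℕ, 1 ≤ h ∧ h ≤ K2 ∧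
      (q = rp2 M K2 ε h ∨ ∃ i : ℕ, 1 ≤ i ∧ i ≤ M ∧ q = CG5_2 M K2 sat2 ε h i)}

lemma rho_sq : rho ^ 2 = 1 / 2 := by
  rw [rho, div_pow, Real.sq_sqrt (by norm_num), one_pow]

/-- Points over the two orthogonal circles are at distance at least `c` as soon as their radial
and axial coordinates satisfy the corresponding Pythagorean inequality. -/
lemma le_dist_rot1_rot2 {M K1 K2 h1 i h2 j : ℕ} {a b a' b' c : ℝ}
    {p q : EuclideanSpace ℝ (Fin 5)}
    (hp : p = a • rot1 M K1 h1 i + b • e5) (hq : q = a' • rot2 M K2 h2 j + b' • e5)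
    (h : 2 * c ^ 2 ≤ a ^ 2 + a' ^ 2 + (b - b') ^ 2) : c ≤ dist p q := by
  rw [EuclideanSpace.dist_eq]
  apply Real.le_sqrt_of_sq_le
  subst hp hq
  simp only [Real.dist_eq, sq_abs, Fin.sum_univ_five, rot1, rot2, e5, pt5]
  simp only [WithLp.equiv_symm_apply, PiLp.add_apply, PiLp.smul_apply, smul_eq_mul,
    Matrix.cons_val]
  generalize π / 4 + π / 2 * ((h1 * (M + 2) + i : ℕ) : ℝ) / ((K1 * (M + 2) : ℕ) : ℝ) = x
  generalize π / 4 + π / 2 * ((h2 * (M + 2) + j : ℕ) : ℝ) / ((K2 * (M + 2) : ℕ) : ℝ) = y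
  linear_combination h / 2 - (a ^ 2 + a' ^ 2 + (b - b') ^ 2) * rho_sq
    - rho ^ 2 * a ^ 2 * Real.sin_sq_add_cos_sq x - rho ^ 2 * a' ^ 2 * Real.sin_sq_add_cos_sq y

lemma CG5_1_eq (M K1 : ℕ) (sat1 : ℕ → ℕ → Bool) (ε : ℝ) (h i : ℕ) :
    CG5_1 M K1 sat1 ε h i = (if sat1 h i then 1 - 2 * ε else 1 + ε) • rot1 M K1 h i +
      (((i % 2 : ℕ) : ℝ) * (8 * √ε)) • e5 := by
  rw [CG5_1, smul_smul]

lemma CG5_2_eq (M K2 : ℕ) (sat2 : ℕ → ℕ → Bool) (ε : ℝ) (h i : ℕ) :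
    CG5_2 M K2 sat2 ε h i = (if sat2 h i then 1 - 2 * ε else 1 + ε) • rot2 M K2 h i +
      (((i % 2 : ℕ) : ℝ) * (8 * √ε)) • e5 := by
  rw [CG5_2, smul_smul]

lemma rp1_eq (M K1 : ℕ) (ε : ℝ) (h : ℕ) :
    rp1 M K1 ε h = (1 : ℝ) • rot1 M K1 h 0 + (-(8 * √ε)) • e5 := by
  rw [rp1]; module

lemma rp2_eq (M K2 : ℕ) (ε : ℝ) (h : ℕ) :
    rp2 M K2 ε h = (1 : ℝ) • rot2 M K2 h 0 + (-(8 * √ε)) • e5 := by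
  rw [rp2]; module

lemma tp1_eq (M K1 : ℕ) (ε : ℝ) (h : ℕ) :
    tp1 M K1 ε h = (1 - 400 * ε) • rot1 M K1 h (M + 1) + (-(10 * √ε)) • e5 := by
  rw [tp1]; module

lemma sp2star_eq (M : ℕ) (ε : ℝ) :
    sp2star ε = (0 : ℝ) • rot2 M 0 0 0 + (1 + 9 * √ε) • e5 := by
  rw [sp2star]; module

lemma tp2star_eq (M : ℕ) (ε : ℝ) :
    tp2star ε = (0 : ℝ) • rot2 M 0 0 0 + (-(1 + 9 * √ε)) • e5 := by
  rw [tp2star]; module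

lemma one_sub_four_mul_le_sq_ite {ε : ℝ} (hε : 0 ≤ ε) (b : Bool) :
    1 - 4 * ε ≤ (if b then 1 - 2 * ε else 1 + ε) ^ 2 := by
  split_ifs <;> nlinarith

/-- for all sufficiently small `ε > 0`, all of the listed pairs of
points in `ℝ⁵` have Euclidean distance at least `1 + ε`. Elements of `A_1` and `A_2`
are encoded by their indices `h_1 ∈ {1,…,K1}` and `h_2 ∈ {1,…,K2}`. -/
theorem stmt16 (M K1 K2 : ℕ) (hM : 1 ≤ M) (hK1 : 1 ≤ K1) (hK2 : 1 ≤ K2)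
    (sat1 sat2 : ℕ → ℕ → Bool) :
    ∃ ε0 : ℝ, 0 < ε0 ∧ ∀ ε : ℝ, 0 < ε → ε < ε0 →
      (∀ q ∈ Q1 M K1 sat1 ε, (∀ h1 : ℕ, 1 ≤ h1 → h1 ≤ K1 → q ≠ sp1 M K1 ε h1) →
        1 + ε ≤ dist q (sp2star ε)) ∧
      (∀ q ∈ Q1 M K1 sat1 ε, (∀ h1 : ℕ, 1 ≤ h1 → h1 ≤ K1 → q ≠ tp1 M K1 ε h1) →
        1 + ε ≤ dist q (tp2star ε)) ∧
      (∀ h1 h2 i : ℕ, 1 ≤ h1 → h1 ≤ K1 → 1 ≤ h2 → h2 ≤ K2 → 1 ≤ i → i ≤ M →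
        1 + ε ≤ dist (rp1 M K1 ε h1) (CG5_2 M K2 sat2 ε h2 i)) ∧
      (∀ h1 h2 i : ℕ, 1 ≤ h1 → h1 ≤ K1 → 1 ≤ h2 → h2 ≤ K2 → 1 ≤ i → i ≤ M →
        1 + ε ≤ dist (CG5_1 M K1 sat1 ε h1 i) (rp2 M K2 ε h2)) ∧
      (∀ h1 h2 i j : ℕ, 1 ≤ h1 → h1 ≤ K1 → 1 ≤ h2 → h2 ≤ K2 → 1 ≤ i → i ≤ M →
        1 ≤ j → j ≤ M → i % 2 ≠ j % 2 →
        1 + ε ≤ dist (CG5_1 M K1 sat1 ε h1 i) (CG5_2 M K2 sat2 ε h2 j)) ∧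
      (∀ h1 h2 i : ℕ, 1 ≤ h1 → h1 ≤ K1 → 1 ≤ h2 → h2 ≤ K2 → 1 ≤ i → i ≤ M →
        sat1 h1 i = false → sat2 h2 i = false →
        1 + ε ≤ dist (CG5_1 M K1 sat1 ε h1 i) (CG5_2 M K2 sat2 ε h2 i)) := by
  refine ⟨1 / 1000000, by norm_num, fun ε hε hε0 => ?_⟩
  have hsε : √ε ^ 2 = ε := Real.sq_sqrt hε.le
  have hs0 : 0 < √ε := Real.sqrt_pos.2 hε
  have hs1 : √ε < 1 / 1000 := by
    rw [Real.sqrt_lt' (by norm_num)]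
    linarith
  have hεs : 1000 * ε ≤ √ε := by nlinarith
  have hεε : ε ^ 2 ≤ ε := by nlinarith
  have hε2 : 0 ≤ ε ^ 2 := sq_nonneg ε
  have hsat := one_sub_four_mul_le_sq_ite hε.le
  refine ⟨?_, ?_, ?_, ?_, ?_, ?_⟩
  · rintro q ⟨h, hh, hhK, rfl | rfl | rfl | ⟨i, -, -, rfl⟩⟩ hq
    · exact absurd rfl (hq h hh hhK)
    · refine le_dist_rot1_rot2 (tp1_eq ..) (sp2star_eq M ε) ?_
      linarith
    · refine le_dist_rot1_rot2 (rp1_eq ..) (sp2star_eq M ε) ?_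
      linarith
    · refine le_dist_rot1_rot2 (CG5_1_eq ..) (sp2star_eq M ε) ?_
      have := hsat (sat1 h i)
      rcases Nat.mod_two_eq_zero_or_one i with hi | hi <;> rw [hi] <;> push_cast <;> linarith
  · rintro q ⟨h, hh, hhK, rfl | rfl | rfl | ⟨i, -, -, rfl⟩⟩ hq
    · refine le_dist_rot1_rot2 rfl (tp2star_eq M ε) ?_
      linarith
    · exact absurd rfl (hq h hh hhK)
    · refine le_dist_rot1_rot2 (rp1_eq ..) (tp2star_eq M ε) ?_
      linarith
    · refine le_dist_rot1_rot2 (CG5_1_eq ..) (tp2star_eq M ε) ?_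
      have := hsat (sat1 h i)
      rcases Nat.mod_two_eq_zero_or_one i with hi | hi <;> rw [hi] <;> push_cast <;> linarith
  · intro h1 h2 i _ _ _ _ _ _
    refine le_dist_rot1_rot2 (rp1_eq ..) (CG5_2_eq ..) ?_
    have := hsat (sat2 h2 i)
    rcases Nat.mod_two_eq_zero_or_one i with hi | hi <;> rw [hi] <;> push_cast <;> linarith
  · intro h1 h2 i _ _ _ _ _ _
    refine le_dist_rot1_rot2 (CG5_1_eq ..) (rp2_eq ..) ?_
    have := hsat (sat1 h1 i)
    rcases Nat.mod_two_eq_zero_or_one i with hi | hi <;> rw [hi] <;> push_cast <;> linarith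
  · intro h1 h2 i j _ _ _ _ _ _ _ _ hij
    refine le_dist_rot1_rot2 (CG5_1_eq ..) (CG5_2_eq ..) ?_
    have := hsat (sat1 h1 i)
    have := hsat (sat2 h2 j)
    rcases Nat.mod_two_eq_zero_or_one i with hi | hi <;>
      rcases Nat.mod_two_eq_zero_or_one j with hj | hj
    · omega
    · rw [hi, hj]; push_cast; linarith
    · rw [hi, hj]; push_cast; linarith
    · omega
  · intro h1 h2 i _ _ _ _ _ _ hs1 hs2
    refine le_dist_rot1_rot2 (CG5_1_eq ..) (CG5_2_eq ..) ?_
    simp [hs1, hs2, two_mul]
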